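/- arXiv:2502.18419 — 2 statements merged into one kernel-verified Lean document; each statement's English description precedes it below -/
import Mathlib

section
/- Let 1 ≤ m ≤ n be integers and let (ℐ, (I_α, J_α)_{α∈ℐ}, (c_α)_{α∈ℐ}) be a quadratic expression over Gr(m,m+n). Then ∑_{α∈ℐ} c_α Δ_{I_α}(𝒜) Δ_{J_α}(𝒜) ≥ 0 for every full-rank (m+n)×m real matrix 𝒜 all of whose Plücker coordinates are nonnegative if and only if, for every pair u, v ∈ {1,…,m+n} with |u−v| = 1, the transformed expression ∑_{α∈ℐ(u,v)} c_α Δ_{I_α(u,v)}(𝒜) Δ_{J_α(u,v)}(𝒜) ≥ 0 for every such matrix 𝒜 (with the convention that a sum over the empty set equals 0). -/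
open Finset

/-- The Plücker coordinate `Δ_I(A)`: the determinant of the `m × m` submatrix of `A`
whose rows are indexed by `I` in increasing order (and all `m` columns);
junk value `0` when `I` does not have `m` elements. -/
noncomputable def pluck {N m : ℕ} (A : Matrix (Fin N) (Fin m) ℝ) (I : Finset (Fin N)) : ℝ :=
  if h : I.card = m then (A.submatrix (fun k => ((I.orderIsoOfFin h) k : Fin N)) id).det else 0

/-- The Chevalley operation `I ↦ I(u,v)` on index sets. -/
def chev {N : ℕ} (I : Finset (Fin N)) (u v : Fin N) : Finset (Fin N) :=
  if u ∈ I ∧ v ∉ I then insert v (I.erase u) else I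

/-- `|α(u,v)| = #{X ∈ {I, J} : u ∈ X and v ∉ X}`. -/
def chevWt {N : ℕ} (I J : Finset (Fin N)) (u v : Fin N) : ℕ :=
  (if u ∈ I ∧ v ∉ I then 1 else 0) + (if u ∈ J ∧ v ∉ J then 1 else 0)

/-- The index set `ℐ(u,v)` of the Chevalley operation: those `α` achieving the maximal
weight `|α(u,v)|` over the family. -/
def chevSet {N : ℕ} {ι : Type} (S : Finset ι) (I J : ι → Finset (Fin N)) (u v : Fin N) :
    Finset ι :=
  S.filter (fun α => chevWt (I α) (J α) u v = S.sup (fun β => chevWt (I β) (J β) u v))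

/-- The linear form `x ↦ det (x, A_K)`, where `A_K` lists the rows of `A` indexed by `K` in
increasing order. -/
noncomputable def sideForm {N p : ℕ} (A : Matrix (Fin N) (Fin (p + 1)) ℝ) (K : Finset (Fin N))
    (hK : K.card = p) : (Fin (p + 1) → ℝ) →ₗ[ℝ] ℝ where
  toFun x := (Matrix.detRowAlternating (n := Fin (p + 1)) (R := ℝ)).curryLeft x
    (fun j => A (K.orderEmbOfFin hK j))
  map_add' x y := by rw [map_add]; rfl
  map_smul' r x := by rw [map_smul]; rfl

theorem sideForm_apply {N p : ℕ} (A : Matrix (Fin N) (Fin (p + 1)) ℝ) (K : Finset (Fin N))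
    (hK : K.card = p) (x : Fin (p + 1) → ℝ) :
    sideForm A K hK x =
      (Matrix.of (Matrix.vecCons x (fun j => A (K.orderEmbOfFin hK j)))).det := rfl

theorem sideForm_congr {N p : ℕ} {A B : Matrix (Fin N) (Fin (p + 1)) ℝ} {K : Finset (Fin N)}
    (hK : K.card = p) (h : ∀ k ∈ K, A k = B k) : sideForm A K hK = sideForm B K hK := by
  refine LinearMap.ext fun x => ?_
  have : (fun j => A (K.orderEmbOfFin hK j)) = fun j => B (K.orderEmbOfFin hK j) :=
    funext fun j => h _ (K.orderEmbOfFin_mem hK j)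
  rw [sideForm_apply, sideForm_apply, this]

theorem pluck_eq_zero_of_card_ne {N m : ℕ} (A : Matrix (Fin N) (Fin m) ℝ) {K : Finset (Fin N)}
    (hK : K.card ≠ m) : pluck A K = 0 := by
  simp [pluck, hK]

theorem card_eq_of_pluck_ne_zero {N m : ℕ} {A : Matrix (Fin N) (Fin m) ℝ} {K : Finset (Fin N)}
    (h : pluck A K ≠ 0) : K.card = m := by
  by_contra hK
  exact h (pluck_eq_zero_of_card_ne A hK)

theorem pluck_insert {N p : ℕ} (A : Matrix (Fin N) (Fin (p + 1)) ℝ) {K : Finset (Fin N)}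
    (hK : K.card = p) {x : Fin N} (hx : x ∉ K) :
    pluck A (insert x K) = (-1) ^ (K.filter (· < x)).card * sideForm A K hK (A x) := by
  have hc : (insert x K).card = p + 1 := by rw [card_insert_of_notMem hx, hK]
  set e := (insert x K).orderEmbOfFin hc with he
  obtain ⟨q, hq⟩ : ∃ q, e q = x := by
    have : x ∈ Set.range e := by
      rw [he, range_orderEmbOfFin]; simp
    exact this
  have hsucc : (fun j => e (q.succAbove j)) = K.orderEmbOfFin hK := by
    apply orderEmbOfFin_unique
    · intro j
      have h1 : e (q.succAbove j) ∈ insert x K := orderEmbOfFin_mem _ hc _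
      have h2 : e (q.succAbove j) ≠ x := by
        rw [← hq]; exact fun h => q.succAbove_ne j (e.injective h)
      exact (mem_insert.1 h1).resolve_left h2
    · exact e.strictMono.comp (Fin.strictMono_succAbove q)
  have hcard : (K.filter (· < x)).card = q := by
    have : K.filter (· < x) = (Finset.Iio q).map e.toEmbedding := by
      ext y
      simp only [mem_filter, mem_map, mem_Iio, RelEmbedding.coe_toEmbedding]
      constructor
      · rintro ⟨hy, hyx⟩
        have : y ∈ Set.range e := by
          rw [he, range_orderEmbOfFin]; simp [hy]
        obtain ⟨j, rfl⟩ := this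
        exact ⟨j, by rwa [← hq, e.lt_iff_lt] at hyx, rfl⟩
      · rintro ⟨j, hj, rfl⟩
        have h1 : e j ∈ insert x K := orderEmbOfFin_mem _ hc _
        have h2 : e j < x := by rw [← hq]; exact e.strictMono hj
        exact ⟨(mem_insert.1 h1).resolve_left h2.ne, h2⟩
    rw [this, card_map, Fin.card_Iio]
  have hp : pluck A (insert x K) = (A.submatrix e id).det := by
    rw [pluck, dif_pos hc]; rfl
  have hs : Matrix.of (Matrix.vecCons (A x) (fun j => A (K.orderEmbOfFin hK j))) =
      (A.submatrix e id).submatrix q.cycleRange.symm id := by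
    ext i j
    refine Fin.cases ?_ (fun i => ?_) i
    · simp [Fin.cycleRange_symm_zero, hq]
    · simp [Fin.cycleRange_symm_succ, ← hsucc]
  rw [hp, sideForm_apply, hs, Matrix.det_permute, Equiv.Perm.sign_symm, Fin.sign_cycleRange,
    hcard, ← mul_assoc]
  push_cast
  rw [← mul_pow]
  simp

theorem sideForm_of_mem {N p : ℕ} (A : Matrix (Fin N) (Fin (p + 1)) ℝ) {K : Finset (Fin N)}
    (hK : K.card = p) {x : Fin N} (hx : x ∈ K) : sideForm A K hK (A x) = 0 := by
  have : x ∈ Set.range (K.orderEmbOfFin hK) := by rw [range_orderEmbOfFin]; exact hx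
  obtain ⟨j, rfl⟩ := this
  rw [sideForm_apply]
  exact Matrix.det_zero_of_row_eq (Fin.succ_ne_zero j).symm rfl

theorem sideForm_mul_comm {N p : ℕ} (A : Matrix (Fin N) (Fin (p + 1)) ℝ) {K K' : Finset (Fin N)}
    (hK : K.card = p) (hK' : K'.card = p) (h : ∀ k ∈ K', sideForm A K hK (A k) = 0)
    (x y : Fin (p + 1) → ℝ) :
    sideForm A K hK x * sideForm A K' hK' y = sideForm A K hK y * sideForm A K' hK' x := by
  set φ := sideForm A K hK
  by_cases hφ : φ = 0
  · simp [hφ]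
  have key : sideForm A K' hK' (φ x • y - φ y • x) = 0 := by
    rw [sideForm_apply, ← Matrix.exists_mulVec_eq_zero_iff]
    refine ⟨fun j => φ (Pi.single j 1), fun h0 => hφ ?_, ?_⟩
    · refine LinearMap.pi_ext' fun j => LinearMap.ext_ring ?_
      simpa using congrFun h0 j
    · have hsum : ∀ z : Fin (p + 1) → ℝ, (z ⬝ᵥ fun j => φ (Pi.single j 1)) = φ z := by
        intro z
        rw [LinearMap.pi_apply_eq_sum_univ φ z]
        simp only [dotProduct, smul_eq_mul]
        refine sum_congr rfl fun j _ => ?_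
        congr 2
        ext k
        simp [Pi.single_apply, eq_comm]
      ext i
      rw [Matrix.mulVec, hsum]
      refine Fin.cases ?_ (fun i => ?_) i
      · change φ (φ x • y - φ y • x) = 0
        simp [mul_comm]
      · simpa using h _ (K'.orderEmbOfFin_mem hK' i)
  rw [map_sub, map_smul, map_smul, smul_eq_mul, smul_eq_mul, sub_eq_zero] at key
  exact key

theorem pluck_ne_zero_iff {N m : ℕ} (A : Matrix (Fin N) (Fin m) ℝ) {K : Finset (Fin N)}
    (hK : K.card = m) : pluck A K ≠ 0 ↔ LinearIndepOn ℝ A.row (K : Set (Fin N)) := by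
  rw [pluck, dif_pos hK, ← isUnit_iff_ne_zero, ← Matrix.isUnit_iff_isUnit_det,
    ← Matrix.linearIndependent_rows_iff_isUnit]
  exact linearIndependent_equiv (R := ℝ) (f := fun k : (K : Set (Fin N)) => A.row k)
    (K.orderIsoOfFin hK).toEquiv

theorem span_row_image_eq_top {N m : ℕ} {A : Matrix (Fin N) (Fin m) ℝ} {K : Finset (Fin N)}
    (hK : K.card = m) (h : LinearIndepOn ℝ A.row (K : Set (Fin N))) :
    Submodule.span ℝ (A.row '' (K : Set (Fin N))) = ⊤ := by
  have := LinearIndependent.span_eq_top_of_card_eq_finrank' (K := ℝ)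
    (b := fun k : (K : Set (Fin N)) => A.row k) h (by simp [hK])
  rwa [← Set.image_eq_range] at this

theorem rank_eq_iff_exists_pluck_ne_zero {N m : ℕ} (A : Matrix (Fin N) (Fin m) ℝ) :
    A.rank = m ↔ ∃ K, pluck A K ≠ 0 := by
  rw [Matrix.rank_eq_finrank_span_row]
  constructor
  · intro h
    obtain ⟨b, -, -, hb, hli⟩ := exists_linearIndepOn_extension
      (K := ℝ) (v := A.row) (linearIndepOn_empty ℝ A.row) (Set.empty_subset Set.univ)
    classical
    have hfin : (b.toFinset : Set (Fin N)) = b := by simp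
    have hspan : Submodule.span ℝ (A.row '' b) = Submodule.span ℝ (Set.range A.row) := by
      apply le_antisymm
      · exact Submodule.span_mono (Set.image_subset_range _ _)
      · rw [Submodule.span_le, ← Set.image_univ]; exact hb
    have hcard : b.toFinset.card = m := by
      have h2 := finrank_span_eq_card (R := ℝ) (b := fun k : b => A.row k) hli
      rw [← Set.image_eq_range, hspan, h] at h2
      rw [h2, Set.toFinset_card]
    exact ⟨b.toFinset, (pluck_ne_zero_iff A hcard).2 (by rwa [hfin])⟩
  · rintro ⟨K, hK⟩
    have hc := card_eq_of_pluck_ne_zero hK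
    have h1 := span_row_image_eq_top hc ((pluck_ne_zero_iff A hc).1 hK)
    have h2 : Submodule.span ℝ (Set.range A.row) = ⊤ :=
      top_le_iff.1 (h1 ▸ Submodule.span_mono (Set.image_subset_range _ _))
    rw [h2]; simp

theorem LinearIndepOn.mem_span_image_essential {ι V : Type*} [AddCommGroup V] [Module ℝ V]
    {v : ι → V} {B : Finset ι} (hB : LinearIndepOn ℝ v (B : Set ι)) {y : V}
    (hy : y ∈ Submodule.span ℝ (v '' (B : Set ι))) :
    y ∈ Submodule.span ℝ
      (v '' {b | b ∈ B ∧ y ∉ Submodule.span ℝ (v '' ((B : Set ι) \ {b}))}) := by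
  classical
  obtain ⟨c, rfl⟩ := (Submodule.mem_span_image_finset_iff_exists_fun' ℝ).1 hy
  refine Submodule.sum_mem _ fun b hb => ?_
  by_cases hcb : c b = 0
  · simp [hcb]
  refine Submodule.smul_mem _ _ (Submodule.subset_span ⟨b, ⟨hb, fun hmem => ?_⟩, rfl⟩)
  have hins : LinearIndepOn ℝ v (insert b ((B : Set ι) \ {b})) := by
    rwa [Set.insert_sdiff_singleton, Set.insert_eq_of_mem (by exact_mod_cast hb)]
  apply hins.notMem_span_of_insert (by simp)
  rw [← add_sum_erase _ _ hb] at hmem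
  have hrest : ∑ x ∈ B.erase b, c x • v x ∈ Submodule.span ℝ (v '' ((B : Set ι) \ {b})) := by
    refine Submodule.sum_mem _ fun x hx =>
      Submodule.smul_mem _ _ (Submodule.subset_span ⟨x, ?_, rfl⟩)
    simpa [and_comm] using hx
  have := (Submodule.add_mem_iff_left _ hrest).1 hmem
  exact (Submodule.smul_mem_iff _ hcb).1 this

/-- Basis exchange for Plücker coordinates. -/
theorem pluck_exchange_ne_zero {N m : ℕ} {A : Matrix (Fin N) (Fin m) ℝ} {B : Finset (Fin N)}
    (hB : pluck A B ≠ 0) {b x : Fin N} (hb : b ∈ B) (hx : x ∉ B)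
    (h : A.row x ∉ Submodule.span ℝ (A.row '' ((B : Set (Fin N)) \ {b}))) :
    pluck A (insert x (B.erase b)) ≠ 0 := by
  have hc := card_eq_of_pluck_ne_zero hB
  have hli := (pluck_ne_zero_iff A hc).1 hB
  have hxe : x ∉ B.erase b := fun h => hx (mem_of_mem_erase h)
  have hc' : (insert x (B.erase b)).card = m := by
    rw [card_insert_of_notMem hxe, card_erase_add_one hb, hc]
  rw [pluck_ne_zero_iff A hc', coe_insert, coe_erase, linearIndepOn_insert (by simp [hx])]
  exact ⟨hli.mono Set.sdiff_subset, h⟩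

theorem mem_span_row_essential {N m : ℕ} {A : Matrix (Fin N) (Fin m) ℝ}
    {B : Finset (Fin N)} (hB : pluck A B ≠ 0) (y : Fin m → ℝ) :
    y ∈ Submodule.span ℝ (A.row ''
      {b | b ∈ B ∧ y ∉ Submodule.span ℝ (A.row '' ((B : Set (Fin N)) \ {b}))}) := by
  have hc := card_eq_of_pluck_ne_zero hB
  have hli := (pluck_ne_zero_iff A hc).1 hB
  exact hli.mem_span_image_essential (by rw [span_row_image_eq_top hc hli]; trivial)

/-- If the rows strictly below row `i` are independent and span row `i`, then in every basis that
contains `i` but not `i + 1`, the row `i` can be replaced by the row `i + 1`. -/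
theorem pluck_insert_succ_ne_zero {N p : ℕ} {A : Matrix (Fin N) (Fin (p + 1)) ℝ}
    (hA : ∀ K, 0 ≤ pluck A K) {i u : Fin N} (hiu : (i : ℕ) + 1 = u)
    (hli : LinearIndepOn ℝ A.row {j | i < j})
    (hi : A.row i ∈ Submodule.span ℝ (A.row '' {j | i < j}))
    {K : Finset (Fin N)} (hiK : i ∉ K) (huK : u ∉ K) (hK : pluck A (insert i K) ≠ 0) :
    pluck A (insert u K) ≠ 0 := by
  intro hzero
  have hltu : ∀ j : Fin N, i < j → j ≠ u → u < j := by
    intro j h1 h2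
    rw [Fin.lt_def] at h1 ⊢
    have := Fin.val_ne_of_ne h2
    omega
  have hiltu : i < u := by rw [Fin.lt_def]; omega
  have hcB := card_eq_of_pluck_ne_zero hK
  have hcK : K.card = p := by rw [card_insert_of_notMem hiK] at hcB; omega
  set φ := sideForm A K hcK with hφ
  have hφu : φ (A u) = 0 := by
    rw [pluck_insert A hcK huK] at hzero
    simpa using hzero
  have hφi : φ (A i) ≠ 0 := by
    intro h
    rw [pluck_insert A hcK hiK, ← hφ, h, mul_zero] at hK
    exact hK rfl
  obtain ⟨s, his, hφs⟩ : ∃ s, i < s ∧ φ (A s) ≠ 0 := by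
    by_contra! hcon
    have : Submodule.span ℝ (A.row '' {j | i < j}) ≤ LinearMap.ker φ := by
      rw [Submodule.span_le]
      rintro _ ⟨j, hj, rfl⟩
      exact hcon j hj
    exact hφi (this hi)
  have hsK : s ∉ K := fun h => hφs (sideForm_of_mem A hcK h)
  have hsu : s ≠ u := by rintro rfl; exact hφs hφu
  have hus := hltu s his hsu
  obtain ⟨k, hkK, hki, hk⟩ : ∃ k ∈ K, k < i ∧
      pluck A (insert u ((insert i K).erase k)) ≠ 0 := by
    by_contra! hcon
    have hsuf : LinearIndepOn ℝ A.row (insert u {j | u < j}) :=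
      hli.mono (by rintro j (rfl | hj); exacts [hiltu, hiltu.trans hj])
    refine hsuf.notMem_span_of_insert (lt_irrefl u)
      (Submodule.span_mono (Set.image_mono ?_) (mem_span_row_essential hK (A.row u)))
    rintro b ⟨hb, hbu⟩
    have hex := pluck_exchange_ne_zero hK hb
      (by simp [huK, hiltu.ne'] : u ∉ insert i K) hbu
    rcases mem_insert.1 hb with rfl | hbK
    · rw [erase_insert hiK] at hex
      exact absurd hzero hex
    · refine hltu b (lt_of_not_ge fun hle => ?_) (by rintro rfl; exact huK hbK)
      exact hex (hcon b hbK (lt_of_le_of_ne hle (by rintro rfl; exact hiK hbK)))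
  set L := K.erase k with hL
  have huL : u ∉ L := fun h => huK (mem_of_mem_erase h)
  have hiL : i ∉ L := fun h => hiK (mem_of_mem_erase h)
  have hsL : s ∉ L := fun h => hsK (mem_of_mem_erase h)
  have hkL : k ∉ L := notMem_erase k K
  have hKL : insert k L = K := insert_erase hkK
  have hcK' : (insert u L).card = p := by
    rw [card_insert_of_notMem huL, card_erase_add_one hkK, hcK]
  have hiK' : i ∉ insert u L := by simp [hiltu.ne, hiL]
  have hsK' : s ∉ insert u L := by simp [hsu, hsL]
  set ψ := sideForm A (insert u L) hcK' with hψ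
  have hψi : ψ (A i) ≠ 0 := by
    intro h
    apply hk
    rw [erase_insert_of_ne hki.ne', Finset.insert_comm, pluck_insert A hcK' hiK', ← hψ, h, mul_zero]
  have hcomm : φ (A s) * ψ (A i) = φ (A i) * ψ (A s) := by
    refine sideForm_mul_comm A hcK hcK' (fun j hj => ?_) _ _
    rcases mem_insert.1 hj with rfl | hj
    · exact hφu
    · exact sideForm_of_mem A hcK (mem_of_mem_erase hj)
  have h1 := hA (insert i K)
  have h2 := hA (insert s K)
  have h3 := hA (insert i (insert u L))
  have h4 := hA (insert s (insert u L))
  rw [pluck_insert A hcK hiK, ← hφ, ← hKL, filter_insert, if_pos hki,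
    card_insert_of_notMem (by simp [hkL]), pow_succ] at h1
  rw [pluck_insert A hcK hsK, ← hφ, ← hKL, filter_insert, if_pos (hki.trans his),
    card_insert_of_notMem (by simp [hkL]), pow_succ] at h2
  rw [pluck_insert A hcK' hiK', ← hψ, filter_insert, if_neg hiltu.not_gt] at h3
  rw [pluck_insert A hcK' hsK', ← hψ, filter_insert, if_pos hus,
    card_insert_of_notMem (by simp [huL]), pow_succ] at h4
  have hφφ := mul_ne_zero hφi hφs
  have hψφ := mul_ne_zero hψi hφs
  rcases neg_one_pow_eq_or ℝ (L.filter (· < i)).card with ha | ha <;>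
  rcases neg_one_pow_eq_or ℝ (L.filter (· < s)).card with hb | hb <;>
  rw [ha] at h1 h3 <;> rw [hb] at h2 h4 <;>
  · simp only [one_mul, mul_one, mul_neg, neg_mul, neg_neg, neg_nonneg] at h1 h2 h3 h4
    rcases lt_or_gt_of_ne hφi with hφi | hφi <;> rcases lt_or_gt_of_ne hφs with hφs | hφs <;>
    rcases lt_or_gt_of_ne hψi with hψi | hψi <;>
    first
    | linarith
    | nlinarith [mul_pos_of_neg_of_neg hφs hψi]
    | nlinarith [mul_neg_of_neg_of_pos hφs hψi]
    | nlinarith [mul_neg_of_pos_of_neg hφs hψi]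
    | nlinarith [mul_pos hφs hψi]

/-- With more rows than columns, there is a lowest row that depends on the rows below it. -/
theorem exists_row_mem_span_below {N m : ℕ} (A : Matrix (Fin N) (Fin m) ℝ) (hN : m < N) :
    ∃ i : Fin N, LinearIndepOn ℝ A.row {j | i < j} ∧
      A.row i ∈ Submodule.span ℝ (A.row '' {j | i < j}) := by
  classical
  set D : Finset (Fin N) := univ.filter fun i => A.row i ∈ Submodule.span ℝ (A.row '' {j | i < j})
  have hind : ∀ s : Finset (Fin N), (∀ x ∈ s, ∀ j, x ≤ j → j ∉ D) →
      LinearIndepOn ℝ A.row (s : Set (Fin N)) := by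
    intro s
    induction s using Finset.induction_on_min with
    | empty => intro _; simp
    | insert a s ha ih =>
      intro h
      rw [coe_insert, linearIndepOn_insert (fun h => lt_irrefl a (ha a h))]
      refine ⟨ih fun x hx => h x (mem_insert_of_mem hx), fun hmem => ?_⟩
      refine h a (mem_insert_self _ _) a le_rfl (mem_filter.2 ⟨mem_univ _, ?_⟩)
      exact Submodule.span_mono (Set.image_mono fun j hj => ha j hj) hmem
  have hD : D.Nonempty := by
    rw [nonempty_iff_ne_empty]
    intro hD
    have hli : LinearIndepOn ℝ A.row ((univ : Finset (Fin N)) : Set (Fin N)) :=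
      hind univ (by simp [hD])
    have hli' : LinearIndependent ℝ A.row := by
      rwa [coe_univ, linearIndepOn_univ_iff] at hli
    have := hli'.fintype_card_le_finrank
    simp at this
    omega
  refine ⟨D.max' hD, ?_, (mem_filter.1 (D.max'_mem hD)).2⟩
  have := hind (univ.filter fun j => D.max' hD < j) fun x hx j hxj hj =>
    absurd (D.le_max' j hj) (not_le.2 ((mem_filter.1 hx).2.trans_le hxj))
  simpa using this

theorem chev_of_mem {N : ℕ} {I : Finset (Fin N)} {u v : Fin N} (hu : u ∈ I) (hv : v ∉ I) :
    chev I u v = insert v (I.erase u) := if_pos ⟨hu, hv⟩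

theorem chev_of_not {N : ℕ} {I : Finset (Fin N)} {u v : Fin N} (h : ¬(u ∈ I ∧ v ∉ I)) :
    chev I u v = I := if_neg h

/-- Adding a multiple of a row to an adjacent row changes Plücker coordinates by the
Chevalley operation. -/
theorem pluck_updateRow {N p : ℕ} (A : Matrix (Fin N) (Fin (p + 1)) ℝ) {u v : Fin N}
    (huv : (u : ℕ) + 1 = v ∨ (v : ℕ) + 1 = u) (t : ℝ) (I : Finset (Fin N)) :
    pluck (A.updateRow u (A u + t • A v)) I =
      pluck A I + if u ∈ I ∧ v ∉ I then t * pluck A (chev I u v) else 0 := by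
  by_cases hc : I.card = p + 1
  swap
  · have hch : (chev I u v).card ≠ p + 1 := by
      rw [chev]
      split_ifs with h
      · rwa [card_insert_of_notMem (fun h' => h.2 (mem_of_mem_erase h')),
          card_erase_add_one h.1]
      · exact hc
    simp [pluck_eq_zero_of_card_ne _ hc, pluck_eq_zero_of_card_ne _ hch]
  by_cases hu : u ∈ I
  swap
  · rw [if_neg (fun h => hu h.1), add_zero, pluck, pluck, dif_pos hc, dif_pos hc]
    congr 1
    ext i j
    have : ((I.orderIsoOfFin hc) i : Fin N) ≠ u := by
      intro h
      exact hu (h ▸ ((I.orderIsoOfFin hc) i).2)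
    rw [Matrix.submatrix_apply, Matrix.submatrix_apply, Matrix.updateRow_ne this]
  obtain ⟨K, huK, rfl⟩ : ∃ K, u ∉ K ∧ insert u K = I :=
    ⟨I.erase u, notMem_erase u I, insert_erase hu⟩
  have hcK : K.card = p := by rw [card_insert_of_notMem huK] at hc; omega
  have hne : u ≠ v := by rintro rfl; omega
  have hside : sideForm (A.updateRow u (A u + t • A v)) K hcK = sideForm A K hcK :=
    sideForm_congr hcK fun k hk => Matrix.updateRow_ne (by rintro rfl; exact huK hk)
  rw [pluck_insert _ hcK huK, pluck_insert A hcK huK, hside, Matrix.updateRow_self, map_add,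
    map_smul, smul_eq_mul, mul_add]
  congr 1
  by_cases hv : v ∈ K
  · rw [sideForm_of_mem A hcK hv, if_neg (by simp [hv])]
    ring
  · have hvI : v ∉ insert u K := by simp [hv, hne.symm]
    have hfil : K.filter (· < u) = K.filter (· < v) := by
      refine filter_congr fun x hx => ?_
      have h1 : (x : ℕ) ≠ u := fun h => huK (Fin.ext h ▸ hx)
      have h2 : (x : ℕ) ≠ v := fun h => hv (Fin.ext h ▸ hx)
      simp only [Fin.lt_def]
      omega
    rw [if_pos ⟨hu, hvI⟩, chev_of_mem hu hvI, erase_insert huK, pluck_insert A hcK hv, hfil]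
    ring

theorem pluck_eq_zero_of_row_eq_zero {N m : ℕ} {A : Matrix (Fin N) (Fin m) ℝ} {i : Fin N}
    (h : A.row i = 0) {K : Finset (Fin N)} (hi : i ∈ K) : pluck A K = 0 := by
  by_contra hK
  exact ((pluck_ne_zero_iff A (card_eq_of_pluck_ne_zero hK)).1 hK).ne_zero
    (by exact_mod_cast hi) h

/-- A nonzero row can be exchanged into any basis that does not contain it. -/
theorem exists_pluck_insert_erase_ne_zero {N m : ℕ} {A : Matrix (Fin N) (Fin m) ℝ}
    {B : Finset (Fin N)} (hB : pluck A B ≠ 0) {i : Fin N} (hi : A.row i ≠ 0) (hiB : i ∉ B) :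
    ∃ b ∈ B, pluck A (insert i (B.erase b)) ≠ 0 := by
  by_contra! hcon
  have := Submodule.span_mono (R := ℝ) (Set.image_mono (f := A.row) (t := ∅)
    (fun b hb => pluck_exchange_ne_zero hB hb.1 hiB hb.2 (hcon b hb.1)))
    (mem_span_row_essential hB (A.row i))
  simp at this
  exact hi this

/-- For a quadratic expression in complementary Plücker coordinates, adding a multiple of a row to
an adjacent row adds a multiple of the Chevalley-transformed expression. -/
theorem sum_pluck_updateRow_of_compl {N p : ℕ} {ι : Type} {S : Finset ι}
    {I J : ι → Finset (Fin N)} (c : ι → ℝ) (hJ : ∀ α ∈ S, J α = (I α)ᶜ) {u v : Fin N}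
    (huv : (u : ℕ) + 1 = v ∨ (v : ℕ) + 1 = u)
    (hsup : S.sup (fun β => chevWt (I β) (J β) u v) ≠ 0)
    (A : Matrix (Fin N) (Fin (p + 1)) ℝ) (t : ℝ) :
    ∑ α ∈ S, c α * pluck (A.updateRow u (A u + t • A v)) (I α) *
        pluck (A.updateRow u (A u + t • A v)) (J α) =
      ∑ α ∈ S, c α * pluck A (I α) * pluck A (J α) +
        t * ∑ α ∈ chevSet S I J u v, c α * pluck A (chev (I α) u v) * pluck A (chev (J α) u v) := by
  have hwt : ∀ α ∈ S, chevWt (I α) (J α) u v ≤ 1 := by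
    intro α hα
    rw [chevWt, hJ α hα]
    by_cases hu : u ∈ I α <;> by_cases hv : v ∈ I α <;> simp [hu, hv]
  have hsup1 : S.sup (fun β => chevWt (I β) (J β) u v) = 1 :=
    le_antisymm (Finset.sup_le hwt) (Nat.one_le_iff_ne_zero.2 hsup)
  rw [chevSet, hsup1, sum_filter, mul_sum, ← sum_add_distrib]
  refine sum_congr rfl fun α hα => ?_
  rw [pluck_updateRow A huv, pluck_updateRow A huv, chevWt, hJ α hα]
  by_cases hu : u ∈ I α <;> by_cases hv : v ∈ I α
  · simp [hu, hv]
  · rw [chev_of_not (I := (I α)ᶜ) (by simp [hu])]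
    simp [hu, hv]
    ring
  · rw [chev_of_not (I := I α) (by simp [hu])]
    simp [hu, hv]
    ring
  · simp [hu, hv]

/-- A totally nonnegative point with two nonzero complementary Plücker coordinates is obtained from
a totally nonnegative point with fewer nonzero Plücker coordinates by adding a nonnegative multiple
of a row to an adjacent row. -/
theorem exists_updateRow_of_pluck_ne_zero {N p : ℕ} {A : Matrix (Fin N) (Fin (p + 1)) ℝ}
    (hN : p + 1 < N) (hA : ∀ K, 0 ≤ pluck A K) {B : Finset (Fin N)} (hB : pluck A B ≠ 0)
    (hB' : pluck A Bᶜ ≠ 0) :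
    ∃ u v : Fin N, ((u : ℕ) + 1 = v ∨ (v : ℕ) + 1 = u) ∧
      ∃ (A' : Matrix (Fin N) (Fin (p + 1)) ℝ) (t : ℝ), 0 ≤ t ∧
        A = A'.updateRow u (A' u + t • A' v) ∧ (∀ K, 0 ≤ pluck A' K) ∧ (∃ K, pluck A' K ≠ 0) ∧
        univ.filter (fun K => pluck A' K ≠ 0) ⊂ univ.filter (fun K => pluck A K ≠ 0) := by
  obtain ⟨i, hli, hi⟩ := exists_row_mem_span_below A hN
  have hi0 : A.row i ≠ 0 := by
    intro h
    by_cases hiB : i ∈ B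
    · exact hB (pluck_eq_zero_of_row_eq_zero h hiB)
    · exact hB' (pluck_eq_zero_of_row_eq_zero h (mem_compl.2 hiB))
  obtain ⟨u, hiu⟩ : ∃ u : Fin N, (i : ℕ) + 1 = u := by
    by_cases hlast : (i : ℕ) + 1 < N
    · exact ⟨⟨i + 1, hlast⟩, rfl⟩
    · have : {j | i < j} = (∅ : Set (Fin N)) := by
        ext j
        simp only [Set.mem_ofPred_eq, Set.mem_empty_iff_false, iff_false, Fin.lt_def]
        omega
      rw [this] at hi
      simp at hi
      exact absurd hi hi0
  have hne : i ≠ u := by rintro rfl; omega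
  obtain ⟨K₁, hiK₁, huK₁, hK₁⟩ : ∃ K, i ∉ K ∧ u ∉ K ∧ pluck A (insert i K) ≠ 0 := by
    obtain ⟨C, huC, hC⟩ : ∃ C, u ∉ C ∧ pluck A C ≠ 0 := by
      by_cases huB : u ∈ B
      · exact ⟨Bᶜ, by simpa using huB, hB'⟩
      · exact ⟨B, huB, hB⟩
    by_cases hiC : i ∈ C
    · exact ⟨C.erase i, notMem_erase i C, fun h => huC (mem_of_mem_erase h),
        by rwa [insert_erase hiC]⟩
    · obtain ⟨b, -, hb⟩ := exists_pluck_insert_erase_ne_zero hC hi0 hiC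
      exact ⟨C.erase b, fun h => hiC (mem_of_mem_erase h), fun h => huC (mem_of_mem_erase h), hb⟩
  obtain ⟨K₀, hK₀, hmin⟩ := exists_min_image
    (univ.filter fun K => i ∉ K ∧ u ∉ K ∧ pluck A (insert i K) ≠ 0)
    (fun K => pluck A (insert u K) / pluck A (insert i K)) ⟨K₁, by simp [*]⟩
  obtain ⟨hiK₀, huK₀, hK₀⟩ := (mem_filter.1 hK₀).2
  set t := pluck A (insert u K₀) / pluck A (insert i K₀) with ht
  have ht0 : 0 ≤ t := div_nonneg (hA _) (hA _)
  have huv : (u : ℕ) + 1 = i ∨ (i : ℕ) + 1 = u := Or.inr hiu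
  set A' := A.updateRow u (A u + (-t) • A i) with hA'
  have hA'u : ∀ K, i ∉ K → u ∉ K →
      pluck A' (insert u K) = pluck A (insert u K) - t * pluck A (insert i K) := by
    intro K hiK huK
    rw [hA', pluck_updateRow A huv, if_pos ⟨mem_insert_self u K, by simp [hne, hiK]⟩,
      chev_of_mem (mem_insert_self u K) (by simp [hne, hiK]), erase_insert huK]
    ring
  have hA'not : ∀ K, ¬(u ∈ K ∧ i ∉ K) → pluck A' K = pluck A K := by
    intro K hK
    rw [hA', pluck_updateRow A huv, if_neg hK, add_zero]
  have hcases : ∀ K, 0 ≤ pluck A' K ∧ pluck A' K ≤ pluck A K := by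
    intro K
    by_cases hK : u ∈ K ∧ i ∉ K
    · obtain ⟨L, huL, rfl⟩ : ∃ L, u ∉ L ∧ insert u L = K :=
        ⟨K.erase u, notMem_erase u K, insert_erase hK.1⟩
      have hiL : i ∉ L := fun h => hK.2 (mem_insert_of_mem h)
      rw [hA'u L hiL huL]
      have h0 := hA (insert i L)
      refine ⟨?_, by nlinarith⟩
      rcases eq_or_ne (pluck A (insert i L)) 0 with h | h
      · rw [h, mul_zero, sub_zero]; exact hA _
      · have := hmin L (by simp [*])
        rw [le_div_iff₀ (lt_of_le_of_ne h0 h.symm)] at this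
        linarith
    · rw [hA'not K hK]
      exact ⟨hA K, le_rfl⟩
  refine ⟨u, i, huv, A', t, ht0, ?_, fun K => (hcases K).1, ⟨insert i K₀, ?_⟩, ?_⟩
  · rw [hA', Matrix.updateRow_self, Matrix.updateRow_ne hne, Matrix.updateRow_idem, add_assoc,
      ← add_smul, neg_add_cancel, zero_smul, add_zero, Matrix.updateRow_eq_self]
  · rwa [hA'not _ (by simp)]
  · rw [Finset.ssubset_iff_of_subset]
    · refine ⟨insert u K₀, ?_, ?_⟩
      · simpa using pluck_insert_succ_ne_zero hA hiu hli hi hiK₀ huK₀ hK₀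
      · simp only [mem_filter, mem_univ, true_and, not_not]
        rw [hA'u _ hiK₀ huK₀, ht, div_mul_cancel₀ _ hK₀, sub_self]
    · intro K hK
      simp only [mem_filter, mem_univ, true_and] at hK ⊢
      intro h
      have := hcases K
      exact hK (le_antisymm (h ▸ this.2) this.1)

theorem sum_pluck_nonneg_of_compl {N p : ℕ} {ι : Type} {S : Finset ι}
    {I J : ι → Finset (Fin N)} (c : ι → ℝ) (hN : p + 1 < N) (hJ : ∀ α ∈ S, J α = (I α)ᶜ)
    (hsup : ∀ u v : Fin N, ((u : ℕ) + 1 = v ∨ (v : ℕ) + 1 = u) →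
      S.sup (fun β => chevWt (I β) (J β) u v) ≠ 0)
    (hchev : ∀ u v : Fin N, ((u : ℕ) + 1 = v ∨ (v : ℕ) + 1 = u) →
      ∀ A : Matrix (Fin N) (Fin (p + 1)) ℝ, A.rank = p + 1 → (∀ K, 0 ≤ pluck A K) →
        0 ≤ ∑ α ∈ chevSet S I J u v, c α * pluck A (chev (I α) u v) * pluck A (chev (J α) u v))
    (A : Matrix (Fin N) (Fin (p + 1)) ℝ) (hA : ∀ K, 0 ≤ pluck A K) :
    0 ≤ ∑ α ∈ S, c α * pluck A (I α) * pluck A (J α) := by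
  induction hs : univ.filter (fun K => pluck A K ≠ 0) using Finset.strongInduction
    generalizing A with
  | H s ih =>
    subst hs
    by_cases hB : ∃ B, pluck A B ≠ 0 ∧ pluck A Bᶜ ≠ 0
    · obtain ⟨B, hB, hB'⟩ := hB
      obtain ⟨u, v, huv, A', t, ht, hAA', hA', hex, hss⟩ :=
        exists_updateRow_of_pluck_ne_zero hN hA hB hB'
      rw [hAA', sum_pluck_updateRow_of_compl c hJ huv (hsup u v huv)]
      exact add_nonneg (ih _ hss A' hA' rfl) (mul_nonneg ht
        (hchev u v huv A' ((rank_eq_iff_exists_pluck_ne_zero A').2 hex) hA'))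
    · push Not at hB
      refine (sum_eq_zero fun α hα => ?_).ge
      rw [hJ α hα]
      by_cases h : pluck A (I α) = 0
      · simp [h]
      · simp [hB _ h]

theorem chevSet_nonneg_of_nonneg {N p : ℕ} {ι : Type} {S : Finset ι} {I J : ι → Finset (Fin N)}
    (c : ι → ℝ)
    (h : ∀ A : Matrix (Fin N) (Fin (p + 1)) ℝ, A.rank = p + 1 → (∀ K, 0 ≤ pluck A K) →
      0 ≤ ∑ α ∈ S, c α * pluck A (I α) * pluck A (J α))
    {u v : Fin N} (huv : (u : ℕ) + 1 = v ∨ (v : ℕ) + 1 = u)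
    (A : Matrix (Fin N) (Fin (p + 1)) ℝ) (hr : A.rank = p + 1) (hA : ∀ K, 0 ≤ pluck A K) :
    0 ≤ ∑ α ∈ chevSet S I J u v, c α * pluck A (chev (I α) u v) * pluck A (chev (J α) u v) := by
  set M := S.sup (fun β => chevWt (I β) (J β) u v) with hM
  let e : Finset (Fin N) → ℕ := fun K => if u ∈ K ∧ v ∉ K then 1 else 0
  let At : ℝ → Matrix (Fin N) (Fin (p + 1)) ℝ := fun t => A.updateRow u (A u + t • A v)
  have hge : ∀ t : ℝ, 0 ≤ t → ∀ K, pluck A K ≤ pluck (At t) K := by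
    intro t ht K
    rw [pluck_updateRow A huv]
    split_ifs
    · exact le_add_of_nonneg_right (mul_nonneg ht (hA _))
    · simp
  have hlim : ∀ K, Filter.Tendsto (fun t => pluck (At t) K / t ^ e K) Filter.atTop
      (nhds (pluck A (chev K u v))) := by
    intro K
    by_cases hK : u ∈ K ∧ v ∉ K
    · have h1 : Filter.Tendsto (fun t : ℝ => pluck A K / t + pluck A (chev K u v)) Filter.atTop
          (nhds (0 + pluck A (chev K u v))) :=
        (tendsto_const_nhds.div_atTop Filter.tendsto_id).add tendsto_const_nhds
      rw [zero_add] at h1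
      refine h1.congr' ?_
      filter_upwards [Filter.eventually_gt_atTop 0] with t ht
      simp only [At, e, pluck_updateRow A huv, if_pos hK, pow_one]
      field_simp
    · simp only [At, e, pluck_updateRow A huv, if_neg hK, pow_zero, div_one, add_zero,
        chev_of_not hK]
      exact tendsto_const_nhds
  have hterm : ∀ α ∈ S, Filter.Tendsto
      (fun t => c α * pluck (At t) (I α) * pluck (At t) (J α) / t ^ M) Filter.atTop
      (nhds (if chevWt (I α) (J α) u v = M then
        c α * pluck A (chev (I α) u v) * pluck A (chev (J α) u v) else 0)) := by
    intro α hα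
    have hle : chevWt (I α) (J α) u v ≤ M :=
      Finset.le_sup (f := fun β => chevWt (I β) (J β) u v) hα
    obtain ⟨d, hd⟩ := Nat.exists_eq_add_of_le hle
    have hdlim : Filter.Tendsto (fun t : ℝ => (t ^ d)⁻¹) Filter.atTop
        (nhds (if chevWt (I α) (J α) u v = M then 1 else 0)) := by
      rcases Nat.eq_zero_or_pos d with rfl | hpos
      · simp [hd]
      · rw [if_neg (by omega)]
        exact (Filter.tendsto_pow_atTop hpos.ne').inv_tendsto_atTop
    have h2 := (((hlim (I α)).const_mul (c α)).mul (hlim (J α))).mul hdlim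
    rw [mul_ite, mul_one, mul_zero] at h2
    refine h2.congr' ?_
    filter_upwards [Filter.eventually_gt_atTop 0] with t ht
    have hMe : M = e (I α) + e (J α) + d := hd
    rw [hMe, pow_add, pow_add]
    field_simp
  rw [chevSet, sum_filter]
  refine ge_of_tendsto (tendsto_finsetSum _ hterm) ?_
  filter_upwards [Filter.eventually_ge_atTop 0] with t ht
  rw [← sum_div]
  refine div_nonneg (h (At t) ?_ fun K => (hA K).trans (hge t ht K)) (pow_nonneg ht _)
  rw [rank_eq_iff_exists_pluck_ne_zero] at hr ⊢
  obtain ⟨K, hK⟩ := hr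
  exact ⟨K, ((lt_of_le_of_ne (hA K) hK.symm).trans_le (hge t ht K)).ne'⟩

theorem chevSet_sum_of_sup_eq_zero {N m : ℕ} {ι : Type} {S : Finset ι} {I J : ι → Finset (Fin N)}
    (c : ι → ℝ) {u v : Fin N} (h : S.sup (fun β => chevWt (I β) (J β) u v) = 0)
    (A : Matrix (Fin N) (Fin m) ℝ) :
    ∑ α ∈ chevSet S I J u v, c α * pluck A (chev (I α) u v) * pluck A (chev (J α) u v) =
      ∑ α ∈ S, c α * pluck A (I α) * pluck A (J α) := by
  have hwt : ∀ α ∈ S, chevWt (I α) (J α) u v = 0 := fun α hα => Nat.le_zero.1 <|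
    h ▸ Finset.le_sup (f := fun β => chevWt (I β) (J β) u v) hα
  rw [chevSet, h, filter_true_of_mem hwt]
  refine sum_congr rfl fun α hα => ?_
  have := hwt α hα
  rw [chevWt] at this
  rw [chev_of_not (I := I α) (by intro h; simp [h] at this),
    chev_of_not (I := J α) (by intro h; simp [h] at this)]

theorem eq_compl_of_sup_ne_zero {N : ℕ} {ι : Type} {S : Finset ι} {I J : ι → Finset (Fin N)}
    (hN : 2 ≤ N)
    (hmulti : ∀ α ∈ S, ∀ β ∈ S, (I α).val + (J α).val = (I β).val + (J β).val)
    (hsup : ∀ u v : Fin N, ((u : ℕ) + 1 = v ∨ (v : ℕ) + 1 = u) →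
      S.sup (fun β => chevWt (I β) (J β) u v) ≠ 0) :
    ∀ α ∈ S, J α = (I α)ᶜ := by
  have hcount : ∀ (u : Fin N) α, (((I α).val + (J α).val).count u) =
      (if u ∈ I α then 1 else 0) + (if u ∈ J α then 1 else 0) := by
    intro u α
    rw [Multiset.count_add, Multiset.count_eq_of_nodup (I α).nodup,
      Multiset.count_eq_of_nodup (J α).nodup]
    rfl
  have hex : ∀ u v : Fin N, ((u : ℕ) + 1 = v ∨ (v : ℕ) + 1 = u) →
      ∃ β ∈ S, chevWt (I β) (J β) u v ≠ 0 := by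
    intro u v huv
    by_contra! hcon
    exact hsup u v huv (Nat.le_zero.1 (Finset.sup_le fun β hβ => (hcon β hβ).le))
  intro α hα
  ext u
  obtain ⟨v, huv⟩ : ∃ v : Fin N, (u : ℕ) + 1 = v ∨ (v : ℕ) + 1 = u := by
    by_cases h : (u : ℕ) + 1 < N
    · exact ⟨⟨u + 1, h⟩, Or.inl rfl⟩
    · exact ⟨⟨u - 1, by omega⟩, Or.inr (by simp only; omega)⟩
  obtain ⟨β, hβ, hwβ⟩ := hex u v huv
  obtain ⟨γ, hγ, hwγ⟩ := hex v u huv.symm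
  have h1 := hcount u α
  have h2 := hcount u β
  have h3 := hcount u γ
  rw [hmulti α hα β hβ] at h1
  rw [hmulti γ hγ β hβ] at h3
  rw [h2] at h1 h3
  rw [chevWt] at hwβ hwγ
  rw [mem_compl]
  grind

/-- Classification of homogeneous quadratic Plücker inequalities over the totally nonnegative
Grassmannian via Chevalley operations: the inequality `∑ c_α Δ_{I_α} Δ_{J_α} ≥ 0` holds over
`Gr^{≥0}(m, m+n)` iff for all consecutive `u, v` the Chevalley-transformed inequality holds. -/
theorem stmt_0 (m n : ℕ) (hm : 1 ≤ m) (hmn : m ≤ n)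
    {ι : Type} (S : Finset ι) (I J : ι → Finset (Fin (m + n))) (c : ι → ℝ)
    (hcard : ∀ α ∈ S, (I α).card = m ∧ (J α).card = m)
    (hmulti : ∀ α ∈ S, ∀ β ∈ S, (I α).val + (J α).val = (I β).val + (J β).val) :
    (∀ A : Matrix (Fin (m + n)) (Fin m) ℝ, A.rank = m →
        (∀ K : Finset (Fin (m + n)), 0 ≤ pluck A K) →
        0 ≤ ∑ α ∈ S, c α * pluck A (I α) * pluck A (J α)) ↔
      (∀ u v : Fin (m + n), ((u : ℕ) + 1 = (v : ℕ) ∨ (v : ℕ) + 1 = (u : ℕ)) →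
        ∀ A : Matrix (Fin (m + n)) (Fin m) ℝ, A.rank = m →
          (∀ K : Finset (Fin (m + n)), 0 ≤ pluck A K) →
          0 ≤ ∑ α ∈ chevSet S I J u v,
              c α * pluck A (chev (I α) u v) * pluck A (chev (J α) u v)) := by
  obtain ⟨p, rfl⟩ : ∃ p, m = p + 1 := ⟨m - 1, by omega⟩
  refine ⟨fun h u v huv A hr hA => chevSet_nonneg_of_nonneg c h huv A hr hA,
    fun h A hr hA => ?_⟩
  by_cases hsup : ∃ u v : Fin (p + 1 + n), ((u : ℕ) + 1 = v ∨ (v : ℕ) + 1 = u) ∧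
      S.sup (fun β => chevWt (I β) (J β) u v) = 0
  · obtain ⟨u, v, huv, hsup⟩ := hsup
    rw [← chevSet_sum_of_sup_eq_zero c hsup A]
    exact h u v huv A hr hA
  · push Not at hsup
    exact sum_pluck_nonneg_of_compl c (by omega)
      (eq_compl_of_sup_ne_zero (by omega) hmulti hsup) hsup h A hA
end

section
/- Let 1 ≤ m ≤ n be integers and let I, J ⊆ {1,…,m+n} be m-element subsets. Then for every full-rank (m+n)×m real matrix 𝒜 all of whose Plücker coordinates are nonnegative, Δ_I(𝒜) · Δ_J(𝒜) ≤ Δ_{min(I,J)}(𝒜) · Δ_{max(I,J)}(𝒜). (Equivalently, the Plücker coordinates are log-supermodular with respect to the coordinatewise min and max operations.) -/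
open Finset

/-- Coordinatewise minimum `min(I,J) = {min(i_k, j_k)}` of two `m`-element sets,
listed in increasing order. -/
def cmin {α : Type*} [LinearOrder α] {m : ℕ} (I J : Finset α)
    (hI : I.card = m) (hJ : J.card = m) : Finset α :=
  Finset.image (fun k : Fin m => min ((I.orderIsoOfFin hI) k : α) ((J.orderIsoOfFin hJ) k : α))
    Finset.univ

/-- Coordinatewise maximum `max(I,J) = {max(i_k, j_k)}` of two `m`-element sets,
listed in increasing order. -/
def cmax {α : Type*} [LinearOrder α] {m : ℕ} (I J : Finset α)
    (hI : I.card = m) (hJ : J.card = m) : Finset α :=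
  Finset.image (fun k : Fin m => max ((I.orderIsoOfFin hI) k : α) ((J.orderIsoOfFin hJ) k : α))
    Finset.univ

/-- The determinant of the rows of `A` listed by `u`. -/
noncomputable def rowDet {N m : ℕ} (A : Matrix (Fin N) (Fin m) ℝ) (u : Fin m → Fin N) : ℝ :=
  (A.submatrix u id).det

/-- The three-term Plücker relation, for two rows of a nonsingular matrix. -/
theorem det_updateRow_three_term {ι : Type*} [Fintype ι] [DecidableEq ι] (M : Matrix ι ι ℝ)
    {k l : ι} (hkl : k ≠ l) (hM : M.det ≠ 0) (q s : ι → ℝ) :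
    (M.updateRow k q).det * (M.updateRow l s).det +
        ((M.updateRow k q).updateRow l (M k)).det * ((M.updateRow k s).updateRow l (M l)).det =
      M.det * ((M.updateRow k q).updateRow l s).det := by
  obtain ⟨c, hc⟩ : ∃ c : ι → ℝ, q = ∑ i, c i • M i := by
    refine ⟨Matrix.vecMul q M⁻¹, ?_⟩
    have h : Matrix.vecMul (Matrix.vecMul q M⁻¹) M = q := by
      rw [Matrix.vecMul_vecMul, Matrix.nonsing_inv_mul _ (isUnit_iff_ne_zero.mpr hM),
        Matrix.vecMul_one]
    conv_lhs => rw [← h]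
    exact Matrix.vecMul_eq_sum _ _
  have key (y : ι → ℝ) : ((M.updateRow k q).updateRow l y).det =
      c k * (M.updateRow l y).det + c l * ((M.updateRow k (M l)).updateRow l y).det := by
    rw [Matrix.updateRow_comm _ hkl, hc]
    have h := (Matrix.detRowAlternating (n := ι) (R := ℝ)).map_update_sum Finset.univ k
      (fun i => c i • M i) (M.updateRow l y)
    have h' : ((M.updateRow l y).updateRow k (∑ i, c i • M i)).det =
      ∑ i, ((M.updateRow l y).updateRow k (c i • M i)).det := h
    rw [h', ← Finset.sum_subset (Finset.subset_univ {k, l}), Finset.sum_pair hkl]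
    · simp only [Matrix.det_updateRow_smul]
      congr 2
      · congr 1
        ext i j
        by_cases hi : i = k <;> simp [Matrix.updateRow_apply, hi, hkl]
      · rw [Matrix.updateRow_comm _ hkl.symm]
    · intro i _ hi
      simp only [Finset.mem_insert, Finset.mem_singleton, not_or] at hi
      rw [Matrix.det_updateRow_smul, Matrix.det_zero_of_row_eq (Ne.symm hi.1), mul_zero]
      ext j
      simp [Matrix.updateRow_apply, hi.1, hi.2]
  have swap (x y : ι → ℝ) : ((M.updateRow k x).updateRow l y).det =
      -((M.updateRow k y).updateRow l x).det := by
    have h := Matrix.det_permute (Equiv.swap k l) ((M.updateRow k y).updateRow l x)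
    rw [Equiv.Perm.sign_swap hkl] at h
    have h2 : ((M.updateRow k y).updateRow l x).submatrix (Equiv.swap k l) id =
        (M.updateRow k x).updateRow l y := by
      ext i j
      rcases eq_or_ne i k with rfl | hi
      · simp [Matrix.updateRow_apply, hkl]
      · rcases eq_or_ne i l with rfl | hi'
        · simp [Matrix.updateRow_apply, hkl]
        · simp [Matrix.updateRow_apply, hi, hi', Equiv.swap_apply_of_ne_of_ne]
    rw [h2] at h
    simpa using h
  have e1 := key (M l)
  have e2 := key (M k)
  have e3 := key s
  have f0 : (M.updateRow k q).updateRow l (M l) = M.updateRow k q := by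
    ext i j
    by_cases hi : i = l <;> simp [Matrix.updateRow_apply, hi, hkl.symm]
  have f1 : ((M.updateRow k (M l)).updateRow l (M l)).det = 0 :=
    Matrix.det_zero_of_row_eq hkl (by ext j; simp [Matrix.updateRow_apply, hkl])
  have f2 : ((M.updateRow k (M l)).updateRow l (M k)).det = - M.det := by
    rw [swap]; simp
  have f3 : (M.updateRow l (M k)).det = 0 :=
    Matrix.det_zero_of_row_eq hkl (by ext j; simp [Matrix.updateRow_apply, hkl])
  have f4 := swap s (M l)
  rw [f0, f1, Matrix.updateRow_eq_self] at e1
  rw [f2, f3] at e2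
  rw [e1, e2, e3, f4]
  ring

theorem cycleIcc_val {m : ℕ} {k l : Fin m} (h : k ≤ l) (a : Fin m) :
    (Fin.cycleIcc k l a : ℕ) =
      if a < k ∨ l < a then (a : ℕ) else if a = l then (k : ℕ) else a + 1 := by
  have : NeZero m := ⟨by have := a.2; omega⟩
  split_ifs with h1 h2
  · rcases h1 with h1 | h1
    · rw [Fin.cycleIcc_of_lt h1]
    · rw [Fin.cycleIcc_of_gt h1]
  · rw [h2, Fin.cycleIcc_of_last h]
  · push Not at h1
    have h3 : a < l := lt_of_le_of_ne h1.2 h2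
    rw [Fin.cycleIcc_of_ge_of_lt h1.1 h3, Fin.val_add_one_of_lt' (by omega)]

theorem rowDet_comp_perm {N m : ℕ} (A : Matrix (Fin N) (Fin m) ℝ) (u : Fin m → Fin N)
    (σ : Equiv.Perm (Fin m)) :
    rowDet A (u ∘ σ) = Equiv.Perm.sign σ * rowDet A u :=
  Matrix.det_permute σ (A.submatrix u id)

theorem submatrix_update {N m : ℕ} (A : Matrix (Fin N) (Fin m) ℝ) (u : Fin m → Fin N)
    (k : Fin m) (x : Fin N) :
    A.submatrix (Function.update u k x) id = (A.submatrix u id).updateRow k (A x) := by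
  ext i j
  by_cases hi : i = k <;> simp [Matrix.updateRow_apply, hi]

theorem rowDet_update_mul_nonneg {N m : ℕ} {A : Matrix (Fin N) (Fin m) ℝ}
    (hA : ∀ u : Fin m → Fin N, StrictMono u → 0 ≤ rowDet A u)
    {w : Fin m → Fin N} (hw : StrictMono w) {k l : Fin m} (hkl : k < l) {q s : Fin N}
    (hq : (q : ℕ) = w k + 1) (hs : (s : ℕ) = w l + 1)
    (hwq : StrictMono (Function.update w k q)) (hws : StrictMono (Function.update w l s)) :
    0 ≤ rowDet A (Function.update (Function.update w k q) l (w k)) *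
      rowDet A (Function.update (Function.update w k s) l (w l)) := by
  set c := Fin.cycleIcc k l
  have hc := cycleIcc_val hkl.le
  have hwk (a : Fin m) (ha : k < a) : w k + 1 < (w a : ℕ) := by
    have := hwq ha
    simp [ha.ne', Fin.lt_def, hq] at this
    exact this
  have hwl (a : Fin m) (ha : l < a) : w l + 1 < (w a : ℕ) := by
    have := hws ha
    simp [ha.ne', Fin.lt_def, hs] at this
    exact this
  have m1 : StrictMono (Function.update (Function.update w k q) l (w k) ∘ (c⁻¹ : Equiv.Perm (Fin m))) := by
    have aux (a b : Fin m) (h : c a < c b) :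
        Function.update (Function.update w k q) l (w k) a <
          Function.update (Function.update w k q) l (w k) b := by
      rw [Fin.lt_def, hc, hc] at h
      have h1 := @hw a b
      have h2 := hwk b
      have h3 := @hw a k
      have h4 := @hw k b
      simp only [Function.update_apply]
      split_ifs at h ⊢ <;> simp only [Fin.lt_def, Fin.ext_iff] at * <;> omega
    intro a b hab
    exact aux _ _ (by simpa using hab)
  have m2 : StrictMono (Function.update (Function.update w k s) l (w l) ∘ c) := by
    intro a b hab
    have ha := hc a
    have hb := hc b
    have h1 := @hw (c a) (c b)
    have h2 := hwl (c b)
    have h3 := @hw (c a) l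
    have h4 := @hw l (c b)
    simp only [Function.comp, Function.update_apply]
    clear hc m1 hwk hwl hA
    generalize c a = a' at *
    generalize c b = b' at *
    split_ifs at ha hb ⊢ <;> simp only [Fin.lt_def, Fin.ext_iff] at * <;> omega
  have n1 := hA _ m1
  have n2 := hA _ m2
  rw [rowDet_comp_perm] at n1 n2
  rw [Equiv.Perm.sign_inv] at n1
  have := mul_nonneg n1 n2
  rcases Int.units_eq_one_or (Equiv.Perm.sign c) with h | h <;> rw [h] at this <;> simpa using this

theorem rowDet_update_mul_le {N m : ℕ} {A : Matrix (Fin N) (Fin m) ℝ}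
    (hA : ∀ u : Fin m → Fin N, StrictMono u → 0 ≤ rowDet A u)
    {w : Fin m → Fin N} (hw : StrictMono w) (hw0 : rowDet A w ≠ 0) {k l : Fin m} (hkl : k < l)
    {q s : Fin N} (hq : (q : ℕ) = w k + 1) (hs : (s : ℕ) = w l + 1)
    (hwq : StrictMono (Function.update w k q)) (hws : StrictMono (Function.update w l s)) :
    rowDet A (Function.update w k q) * rowDet A (Function.update w l s) ≤
      rowDet A w * rowDet A (Function.update (Function.update w k q) l s) := by
  have h1 := rowDet_update_mul_nonneg hA hw hkl hq hs hwq hws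
  have h2 := det_updateRow_three_term (A.submatrix w id) hkl.ne hw0 (A q) (A s)
  simp only [rowDet, submatrix_update] at h1 ⊢
  change _ * _ + ((Matrix.updateRow _ _ _).updateRow l (A (w k))).det *
    ((Matrix.updateRow _ _ _).updateRow l (A (w l))).det = _ at h2
  linarith

theorem strictMono_inf {ι α : Type*} [Preorder ι] [LinearOrder α] {u v : ι → α}
    (hu : StrictMono u) (hv : StrictMono v) : StrictMono (u ⊓ v) :=
  fun _ _ h => min_lt_min (hu h) (hv h)

theorem strictMono_sup {ι α : Type*} [Preorder ι] [LinearOrder α] {u v : ι → α}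
    (hu : StrictMono u) (hv : StrictMono v) : StrictMono (u ⊔ v) :=
  fun _ _ h => max_lt_max (hu h) (hv h)

theorem strictMono_update_of_adjacent {N m : ℕ} {u : Fin m → Fin N} (hu : StrictMono u)
    {k : Fin m} {j : Fin N} (hj : (j : ℕ) = u k + 1 ∨ (u k : ℕ) = j + 1)
    (hne : ∀ b, u b ≠ j) : StrictMono (Function.update u k j) := by
  intro a b hab
  have h1 := hu hab
  have h2 := hne a
  have h3 := hne b
  simp only [Function.update_apply]
  split_ifs with ha hb hb
  · omega
  · subst ha; omega
  · subst hb; omega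
  · exact h1

theorem exists_unit_step {N m : ℕ} {w u : Fin m → Fin N} (hw : StrictMono w) (hu : StrictMono u)
    (hle : w ≤ u) (hne : w ≠ u) :
    ∃ (k : Fin m) (j : Fin N), (j : ℕ) = w k + 1 ∧ j ≤ u k ∧
      StrictMono (Function.update w k j) := by
  obtain ⟨k₀, hk₀⟩ := Function.ne_iff.mp hne
  obtain ⟨k, hk, hmax⟩ := (Finset.univ.filter fun k => w k ≠ u k).exists_max_image id
    ⟨k₀, by simpa using hk₀⟩
  simp only [Finset.mem_filter, Finset.mem_univ, true_and, id] at hk hmax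
  have hlt : w k < u k := lt_of_le_of_ne (hle k) hk
  refine ⟨k, ⟨w k + 1, by omega⟩, rfl, Fin.le_def.mpr hlt,
    strictMono_update_of_adjacent hw (Or.inl rfl) fun b hb => ?_⟩
  have hb' : (w b : ℕ) = w k + 1 := congrArg Fin.val hb
  have hkb : k < b := hw.lt_iff_lt.mp (by omega)
  have hwb : w b = u b := by
    by_contra h
    exact absurd (hmax b h) (not_le.mpr hkb)
  have := hu hkb
  omega

theorem update_le_of_le {N m : ℕ} {w u : Fin m → Fin N} (hle : w ≤ u) {k : Fin m} {j : Fin N}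
    (hj : j ≤ u k) : Function.update w k j ≤ u :=
  update_le_iff.mpr ⟨hj, fun i _ => hle i⟩

theorem sum_update_lt {N m : ℕ} {w : Fin m → Fin N} {k : Fin m} {j : Fin N}
    (hj : (j : ℕ) = w k + 1) :
    ∑ i, (w i : ℕ) < ∑ i, (Function.update w k j i : ℕ) := by
  apply Finset.sum_lt_sum
  · intro i _
    simp only [Function.update_apply]
    split_ifs with h
    · subst h; omega
    · exact le_rfl
  · exact ⟨k, Finset.mem_univ _, by simp [hj]⟩

theorem sum_lt_sum_of_lt {N m : ℕ} {u v : Fin m → Fin N} (h : u < v) :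
    ∑ i, (u i : ℕ) < ∑ i, (v i : ℕ) := by
  obtain ⟨hle, i, hi⟩ := Pi.lt_def.mp h
  exact Finset.sum_lt_sum (fun i _ => hle i) ⟨i, Finset.mem_univ _, hi⟩

/-- A property of increasing sequences that is invariant under unit steps is constant. -/
theorem iff_of_unit_step {N m : ℕ} {P : (Fin m → Fin N) → Prop}
    (hP : ∀ (w : Fin m → Fin N) (k : Fin m) (j : Fin N), StrictMono w → (j : ℕ) = w k + 1 →
      StrictMono (Function.update w k j) → (P w ↔ P (Function.update w k j)))
    {u v : Fin m → Fin N} (hu : StrictMono u) (hv : StrictMono v) : P u ↔ P v := by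
  have key (n : ℕ) : ∀ w u : Fin m → Fin N, StrictMono w → StrictMono u → w ≤ u →
      (∑ i, (u i : ℕ)) - ∑ i, (w i : ℕ) = n → (P w ↔ P u) := by
    induction n using Nat.strong_induction_on with
    | _ n ih =>
      intro w u hw hu hle hn
      rcases eq_or_ne w u with rfl | hne
      · rfl
      · obtain ⟨k, j, hj, hju, hmono⟩ := exists_unit_step hw hu hle hne
        have h1 := sum_update_lt hj
        have h2 := sum_lt_sum_of_lt (lt_of_le_of_ne hle hne)
        exact (hP w k j hw hj hmono).trans
          (ih _ (by omega) _ _ hmono hu (update_le_of_le hle hju) rfl)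
  exact (key _ _ _ (strictMono_inf hu hv) hu inf_le_left rfl).symm.trans
    (key _ _ _ (strictMono_inf hu hv) hv inf_le_right rfl)

/-- A positive function on increasing sequences that is locally log-supermodular is
log-supermodular. -/
theorem mul_le_inf_mul_sup_of_local {N m : ℕ} {f : (Fin m → Fin N) → ℝ}
    (hpos : ∀ u, StrictMono u → 0 < f u)
    (hloc : ∀ (w : Fin m → Fin N) (k l : Fin m) (q s : Fin N), StrictMono w → k < l →
      (q : ℕ) = w k + 1 → (s : ℕ) = w l + 1 → StrictMono (Function.update w k q) →
      StrictMono (Function.update w l s) →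
      f (Function.update w k q) * f (Function.update w l s) ≤
        f w * f (Function.update (Function.update w k q) l s))
    {u v : Fin m → Fin N} (hu : StrictMono u) (hv : StrictMono v) :
    f u * f v ≤ f (u ⊓ v) * f (u ⊔ v) := by
  have key (n : ℕ) : ∀ u v : Fin m → Fin N, StrictMono u → StrictMono v →
      (∑ i, ((u ⊔ v) i : ℕ)) - ∑ i, ((u ⊓ v) i : ℕ) = n →
      f u * f v ≤ f (u ⊓ v) * f (u ⊔ v) := by
    induction n using Nat.strong_induction_on with
    | _ n ih =>
      -- if `x` lies strictly between `u ⊓ v` and `u`, split the interval at `x`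
      have split (u v x : Fin m → Fin N) (hu : StrictMono u) (hv : StrictMono v)
          (hx : StrictMono x) (hn : (∑ i, ((u ⊔ v) i : ℕ)) - ∑ i, ((u ⊓ v) i : ℕ) = n)
          (hwx : u ⊓ v < x) (hxu : x < u) : f u * f v ≤ f (u ⊓ v) * f (u ⊔ v) := by
        have e1 : x ⊓ v = u ⊓ v :=
          le_antisymm (inf_le_inf_right _ hxu.le) (le_inf hwx.le inf_le_right)
        have e2 : u ⊓ (x ⊔ v) = x := by
          rw [inf_sup_left, inf_eq_right.mpr hxu.le, sup_eq_left.mpr hwx.le]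
        have e3 : u ⊔ (x ⊔ v) = u ⊔ v := by
          rw [← sup_assoc, sup_eq_left.mpr hxu.le]
        have hlt : x ⊔ v < u ⊔ v := by
          refine lt_of_le_of_ne (sup_le_sup_right hxu.le _) fun h => ?_
          rw [h, inf_sup_self] at e2
          exact hxu.ne e2.symm
        have s1 := sum_lt_sum_of_lt hwx
        have s2 := sum_lt_sum_of_lt hlt
        have s3 := sum_lt_sum_of_lt hxu
        have s4 : ∑ i, (u i : ℕ) ≤ ∑ i, ((u ⊔ v) i : ℕ) :=
          Finset.sum_le_sum fun i _ => (le_sup_left : u ≤ u ⊔ v) i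
        have s5 : ∑ i, (x i : ℕ) ≤ ∑ i, ((x ⊔ v) i : ℕ) :=
          Finset.sum_le_sum fun i _ => (le_sup_left : x ≤ x ⊔ v) i
        have i1 := ih _ (by rw [e1]; omega) x v hx hv rfl
        have i2 := ih _ (by rw [e2, e3]; omega) u (x ⊔ v) hu (strictMono_sup hx hv) rfl
        rw [e1] at i1
        rw [e2, e3] at i2
        have p1 := hpos x hx
        have p2 := hpos _ (strictMono_sup hx hv)
        have p3 := hpos u hu
        have p4 := hpos _ (strictMono_inf hu hv)
        refine le_of_mul_le_mul_right ?_ (mul_pos p1 p2)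
        calc f u * f v * (f x * f (x ⊔ v)) = (f x * f v) * (f u * f (x ⊔ v)) := by ring
          _ ≤ (f (u ⊓ v) * f (x ⊔ v)) * (f x * f (u ⊔ v)) :=
            mul_le_mul i1 i2 (mul_pos p3 p2).le (mul_pos p4 p2).le
          _ = _ := by ring
      intro u v hu hv hn
      by_cases huv : u ⊓ v = u
      · have h : u ≤ v := inf_eq_left.mp huv
        rw [huv, sup_eq_right.mpr h]
      by_cases hvu : u ⊓ v = v
      · have h : v ≤ u := inf_eq_right.mp hvu
        rw [hvu, sup_eq_left.mpr h, mul_comm]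
      obtain ⟨k, q, hq, hqu, hk⟩ := exists_unit_step (strictMono_inf hu hv) hu inf_le_left huv
      obtain ⟨l, s, hs, hsv, hl⟩ := exists_unit_step (strictMono_inf hu hv) hv inf_le_right hvu
      have lt_step {k : Fin m} {q : Fin N} (hq : (q : ℕ) = (u ⊓ v) k + 1) :
          u ⊓ v < Function.update (u ⊓ v) k q :=
        lt_update_self_iff.mpr (Fin.lt_def.mpr (by omega))
      rcases eq_or_ne (Function.update (u ⊓ v) k q) u with h1 | h1
      · rcases eq_or_ne (Function.update (u ⊓ v) l s) v with h2 | h2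
        · have hkl : k ≠ l := by
            rintro rfl
            have a1 : q = u k := by rw [← h1]; simp
            have a2 : s = v k := by rw [← h2]; simp
            have a3 : (u ⊓ v) k = min (u k) (v k) := rfl
            rw [← a1, ← a2] at a3
            rcases min_choice q s with h | h <;> rw [h] at a3 <;> omega
          have hsup : u ⊔ v = Function.update (Function.update (u ⊓ v) k q) l s := by
            have b1 : (u ⊓ v) k < q := Fin.lt_def.mpr (by omega)
            have b2 : (u ⊓ v) l < s := Fin.lt_def.mpr (by omega)
            have h3 : u ⊔ v = Function.update (u ⊓ v) k q ⊔ Function.update (u ⊓ v) l s := by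
              rw [h1, h2]
            rw [h3]
            funext i
            simp only [Pi.sup_apply, Function.update_apply]
            split_ifs with c1 c2 c2
            · exact absurd (c1.symm.trans c2) hkl
            · subst c1; exact sup_eq_left.mpr b1.le
            · subst c2; exact sup_eq_right.mpr b2.le
            · exact sup_idem _
          rcases lt_or_gt_of_ne hkl with hlt | hlt
          · have := hloc _ k l q s (strictMono_inf hu hv) hlt hq hs hk hl
            rwa [← hsup, h1, h2] at this
          · have := hloc _ l k s q (strictMono_inf hu hv) hlt hs hq hl hk
            rwa [Function.update_comm hkl.symm, ← hsup, h1, h2, mul_comm] at this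
        · have := split v u _ hv hu hl (by rwa [sup_comm, inf_comm])
            (by rw [inf_comm]; exact lt_step hs)
            (lt_of_le_of_ne (update_le_of_le inf_le_right hsv) h2)
          rwa [mul_comm, inf_comm, sup_comm] at this
      · exact split u v _ hu hv hk hn (lt_step hq)
          (lt_of_le_of_ne (update_le_of_le inf_le_left hqu) h1)
  exact key _ u v hu hv rfl

/-- Adding a multiple of row `i` to row `j` changes the minor on rows `u` with `u k = j` by that
multiple of the minor with `j` replaced by `i`. -/
theorem rowDet_updateRow {N m : ℕ} (A : Matrix (Fin N) (Fin m) ℝ) {u : Fin m → Fin N}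
    (hu : Function.Injective u) (i : Fin N) (t : ℝ) (k : Fin m) :
    rowDet (A.updateRow (u k) (A (u k) + t • A i)) u =
      rowDet A u + t * rowDet A (Function.update u k i) := by
  have h : (A.updateRow (u k) (A (u k) + t • A i)).submatrix u id =
      (A.submatrix u id).updateRow k (A.submatrix u id k + t • A i) := by
    ext a b
    by_cases ha : a = k
    · subst ha; simp
    · simp [Matrix.updateRow_apply, ha, hu.ne ha]
  rw [rowDet, h, Matrix.det_updateRow_add, Matrix.det_updateRow_smul, Matrix.updateRow_eq_self,
    ← submatrix_update]
  rfl

theorem rowDet_le_rowDet_updateRow {N m : ℕ} {A : Matrix (Fin N) (Fin m) ℝ}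
    (hA : ∀ u : Fin m → Fin N, StrictMono u → 0 ≤ rowDet A u) {i j : Fin N}
    (hij : (i : ℕ) = j + 1 ∨ (j : ℕ) = i + 1) {t : ℝ} (ht : 0 ≤ t) {u : Fin m → Fin N}
    (hu : StrictMono u) : rowDet A u ≤ rowDet (A.updateRow j (A j + t • A i)) u := by
  by_cases hk : ∃ k, u k = j
  · obtain ⟨k, rfl⟩ := hk
    rw [rowDet_updateRow A hu.injective]
    refine le_add_of_nonneg_right (mul_nonneg ht ?_)
    by_cases hb : ∃ b, u b = i
    · obtain ⟨b, rfl⟩ := hb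
      have hbk : k ≠ b := by rintro rfl; omega
      exact (Matrix.det_zero_of_row_eq hbk (by ext; simp [hbk.symm])).ge
    · push Not at hb
      exact hA _ (strictMono_update_of_adjacent hu hij hb)
  · push Not at hk
    refine le_of_eq (congrArg Matrix.det ?_)
    ext a b
    simp [Matrix.updateRow_apply, hk]

theorem continuous_rowDet_updateRow {N m : ℕ} (A : Matrix (Fin N) (Fin m) ℝ) (i j : Fin N)
    (u : Fin m → Fin N) :
    Continuous fun t : ℝ => rowDet (A.updateRow j (A j + t • A i)) u := by
  refine Continuous.matrix_det (continuous_matrix fun a b => ?_)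
  by_cases h : u a = j
  · simp only [Matrix.submatrix_apply, h, Matrix.updateRow_self, Pi.add_apply, Pi.smul_apply]
    fun_prop
  · simp only [Matrix.submatrix_apply, Matrix.updateRow_ne h]
    fun_prop

theorem rowDet_mul_le_inf_mul_sup {N m : ℕ} (A : Matrix (Fin N) (Fin m) ℝ)
    (hA : ∀ u : Fin m → Fin N, StrictMono u → 0 ≤ rowDet A u)
    {u v : Fin m → Fin N} (hu : StrictMono u) (hv : StrictMono v) :
    rowDet A u * rowDet A v ≤ rowDet A (u ⊓ v) * rowDet A (u ⊔ v) := by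
  classical
  -- induct on the number of vanishing minors, perturbing by elementary row operations
  induction hn : (Finset.univ.filter fun w : Fin m → Fin N =>
      StrictMono w ∧ rowDet A w = 0).card using Nat.strong_induction_on generalizing A with
  | _ n ih =>
    subst hn
    have perturb (i j : Fin N) (hij : (i : ℕ) = j + 1 ∨ (j : ℕ) = i + 1) (w : Fin m → Fin N)
        (hw : StrictMono w) (k : Fin m) (hk : w k = j) (h0 : rowDet A w = 0)
        (h1 : 0 < rowDet A (Function.update w k i)) :
        rowDet A u * rowDet A v ≤ rowDet A (u ⊓ v) * rowDet A (u ⊔ v) := by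
      have hc (x : Fin m → Fin N) : Filter.Tendsto
          (fun t : ℝ => rowDet (A.updateRow j (A j + t • A i)) x) (nhdsWithin 0 (Set.Ioi 0))
          (nhds (rowDet A x)) := by
        have := (continuous_rowDet_updateRow A i j x).tendsto 0
        simp only [zero_smul, add_zero, Matrix.updateRow_eq_self] at this
        exact this.mono_left nhdsWithin_le_nhds
      refine le_of_tendsto_of_tendsto ((hc u).mul (hc v)) ((hc _).mul (hc _)) ?_
      filter_upwards [self_mem_nhdsWithin] with t ht
      have ht : 0 < t := ht
      have hle (x : Fin m → Fin N) (hx : StrictMono x) :=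
        rowDet_le_rowDet_updateRow hA hij ht.le hx
      refine ih _ (Finset.card_lt_card ?_) _ (fun x hx => (hA x hx).trans (hle x hx)) rfl
      rw [Finset.ssubset_iff_of_subset]
      · refine ⟨w, by simp [hw, h0], ?_⟩
        subst hk
        simp only [Finset.mem_filter, not_and]
        intro _ _
        rw [rowDet_updateRow A hw.injective, h0]
        have := mul_pos ht h1
        linarith
      · intro x
        simp only [Finset.mem_filter, Finset.mem_univ, true_and]
        rintro ⟨hx, hx0⟩
        exact ⟨hx, le_antisymm (hx0 ▸ hle x hx) (hA x hx)⟩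
    by_cases hconst : ∀ (w : Fin m → Fin N) (k : Fin m) (j : Fin N), StrictMono w →
        (j : ℕ) = w k + 1 → StrictMono (Function.update w k j) →
        (rowDet A w = 0 ↔ rowDet A (Function.update w k j) = 0)
    · by_cases h0 : rowDet A u = 0
      · rw [h0, zero_mul]
        exact mul_nonneg (hA _ (strictMono_inf hu hv)) (hA _ (strictMono_sup hu hv))
      · have hne (x : Fin m → Fin N) (hx : StrictMono x) : rowDet A x ≠ 0 := fun h =>
          h0 ((iff_of_unit_step (P := fun x => rowDet A x = 0) hconst hu hx).mpr h)
        exact mul_le_inf_mul_sup_of_local (f := rowDet A)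
          (fun x hx => (hA x hx).lt_of_ne' (hne x hx))
          (fun w k l q s hw hkl hq hs => rowDet_update_mul_le hA hw (hne w hw) hkl hq hs) hu hv
    · push Not at hconst
      obtain ⟨w, k, j, hw, hj, hmono, h⟩ := hconst
      rcases h with ⟨h0, h1⟩ | ⟨h1, h0⟩
      · exact perturb j (w k) (Or.inl hj) w hw k rfl h0 ((hA _ hmono).lt_of_ne' h1)
      · refine perturb (w k) j (Or.inr hj) _ hmono k (by simp) h0 ?_
        simpa using (hA _ hw).lt_of_ne' h1

theorem pluck_image {N m : ℕ} (A : Matrix (Fin N) (Fin m) ℝ) {u : Fin m → Fin N}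
    (hu : StrictMono u) : pluck A (Finset.univ.image u) = rowDet A u := by
  have hcard : (Finset.univ.image u).card = m := by
    rw [Finset.card_image_of_injective _ hu.injective, Finset.card_fin]
  have h := Finset.orderEmbOfFin_unique hcard (f := u) (fun x => by simp) hu
  rw [pluck, dif_pos hcard, rowDet]
  conv_rhs => rw [h]
  rfl

/-- Log-supermodularity of Plücker coordinates (Lam):
`Δ_I Δ_J ≤ Δ_{min(I,J)} Δ_{max(I,J)}` over `Gr^{≥0}(m, m+n)`. -/
theorem stmt_5 (m n : ℕ) (hm : 1 ≤ m) (hmn : m ≤ n)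
    (I J : Finset (Fin (m + n))) (hI : I.card = m) (hJ : J.card = m)
    (A : Matrix (Fin (m + n)) (Fin m) ℝ) (hrank : A.rank = m)
    (hpos : ∀ K : Finset (Fin (m + n)), 0 ≤ pluck A K) :
    pluck A I * pluck A J ≤ pluck A (cmin I J hI hJ) * pluck A (cmax I J hI hJ) := by
  have hu := (I.orderEmbOfFin hI).strictMono
  have hv := (J.orderEmbOfFin hJ).strictMono
  have h := rowDet_mul_le_inf_mul_sup A
    (fun w hw => (hpos (Finset.univ.image w)).trans_eq (pluck_image A hw)) hu hv
  rw [← pluck_image A (strictMono_inf hu hv), ← pluck_image A (strictMono_sup hu hv)] at h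
  rw [pluck, pluck, dif_pos hI, dif_pos hJ]
  exact h
end
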